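/- arXiv:1012.5290 — 4 statements merged into one kernel-verified Lean document; each statement's English description precedes it below -/
import Mathlib

section
/- Fix c > 0. There exist constants β₀, K > 0 such that for every β ∈ (0, β₀) one has c < 2/(9β), the map c′ ↦ ∫_ℝ Q_{c′,β}(x)² dx is differentiable at c′ = c, and its derivative d(β) at c satisfies |d(β) − (3/2) c^{1/2} ∫_ℝ Q(x)² dx| ≤ K β; in particular d(β) > 0 (Weinstein's criterium). -/
open MeasureTheory Filter Real

/-- The KdV soliton profile `Q_c(s) = 3c / (1 + cosh(√c s))`;
`Q 1` is the normalized profile `Q(s) = 3/(1 + cosh s)`. -/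
noncomputable def Q (c s : ℝ) : ℝ := 3 * c / (1 + Real.cosh (Real.sqrt c * s))

/-- The Gardner soliton profile `Q_{c,β}(s) = 3c / (1 + ρ cosh(√c s))`,
with `ρ = (1 - (9/2) β c)^{1/2}`. -/
noncomputable def QG (c β s : ℝ) : ℝ :=
  3 * c / (1 + Real.sqrt (1 - 9 / 2 * β * c) * Real.cosh (Real.sqrt c * s))

lemma inv_cosh_sq_le (s : ℝ) : (Real.cosh s ^ 2)⁻¹ ≤ (1 + s ^ 2)⁻¹ := by
  have h : s ^ 2 ≤ Real.sinh s ^ 2 := by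
    rw [sq_le_sq, Real.abs_sinh]
    exact Real.self_le_sinh_iff.2 (abs_nonneg s)
  have h' := Real.cosh_sq s
  gcongr
  linarith

/-- The mass `∫ (1 + r cosh s)⁻² ds` of a rescaled Gardner soliton. -/
noncomputable def soliton_mass (r : ℝ) : ℝ := ∫ s : ℝ, ((1 + r * Real.cosh s) ^ 2)⁻¹

/-- The derivative of `soliton_mass`. -/
noncomputable def soliton_mass_deriv (r : ℝ) : ℝ :=
  ∫ s : ℝ, -(2 * Real.cosh s) / (1 + r * Real.cosh s) ^ 3

lemma soliton_mass_integrand_le {r : ℝ} (hr : 1 / 2 < r) (s : ℝ) :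
    ‖((1 + r * Real.cosh s) ^ 2)⁻¹‖ ≤ 4 * (1 + s ^ 2)⁻¹ := by
  have hC := Real.cosh_pos s
  have h1 : Real.cosh s / 2 ≤ 1 + r * Real.cosh s := by nlinarith
  rw [Real.norm_of_nonneg (by positivity)]
  calc ((1 + r * Real.cosh s) ^ 2)⁻¹ ≤ ((Real.cosh s / 2) ^ 2)⁻¹ := by gcongr
    _ = 4 * (Real.cosh s ^ 2)⁻¹ := by field_simp; norm_num
    _ ≤ _ := by exact mul_le_mul_of_nonneg_left (inv_cosh_sq_le s) (by norm_num)

lemma soliton_mass_deriv_integrand_le {r : ℝ} (hr : 1 / 2 < r) (s : ℝ) :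
    ‖-(2 * Real.cosh s) / (1 + r * Real.cosh s) ^ 3‖ ≤ 16 * (1 + s ^ 2)⁻¹ := by
  have hC := Real.cosh_pos s
  have h1 : Real.cosh s / 2 ≤ 1 + r * Real.cosh s := by nlinarith
  have h2 : 0 < 1 + r * Real.cosh s := by linarith
  rw [neg_div, norm_neg, Real.norm_of_nonneg (by positivity)]
  calc 2 * Real.cosh s / (1 + r * Real.cosh s) ^ 3
      ≤ 2 * Real.cosh s / (Real.cosh s / 2) ^ 3 := by gcongr
    _ = 16 * (Real.cosh s ^ 2)⁻¹ := by field_simp; norm_num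
    _ ≤ _ := by exact mul_le_mul_of_nonneg_left (inv_cosh_sq_le s) (by norm_num)

lemma integrable_soliton_mass_integrand {r : ℝ} (hr : 1 / 2 < r) :
    Integrable fun s : ℝ => ((1 + r * Real.cosh s) ^ 2)⁻¹ :=
  (integrable_inv_one_add_sq.const_mul 4).mono'
    (by apply Measurable.aestronglyMeasurable; fun_prop)
    (Eventually.of_forall (soliton_mass_integrand_le hr))

lemma hasDerivAt_soliton_mass {r : ℝ} (hr : 1 / 2 < r) :
    HasDerivAt soliton_mass (soliton_mass_deriv r) r := by
  refine (hasDerivAt_integral_of_dominated_loc_of_deriv_le (μ := volume)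
    (F := fun r s : ℝ => ((1 + r * Real.cosh s) ^ 2)⁻¹)
    (F' := fun r s : ℝ => -(2 * Real.cosh s) / (1 + r * Real.cosh s) ^ 3)
    (bound := fun s => 16 * (1 + s ^ 2)⁻¹)
    (Ioi_mem_nhds hr) (Eventually.of_forall fun x => ?_)
    (integrable_soliton_mass_integrand hr) ?_
    (Eventually.of_forall fun s x hx => soliton_mass_deriv_integrand_le hx s)
    (integrable_inv_one_add_sq.const_mul 16) (Eventually.of_forall fun s x hx => ?_)).2
  · apply Measurable.aestronglyMeasurable; fun_prop
  · apply Measurable.aestronglyMeasurable; fun_prop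
  · have hC := Real.cosh_pos s
    have hx : 1 / 2 < x := hx
    have h2 : 0 < 1 + x * Real.cosh s := by positivity
    refine (((((hasDerivAt_id' x).mul_const (Real.cosh s)).const_add 1).fun_pow 2).fun_inv
      (pow_ne_zero 2 h2.ne')).congr_deriv ?_
    field_simp
    norm_num
    ring

lemma abs_soliton_mass_deriv_le {r : ℝ} (hr : 1 / 2 < r) :
    |soliton_mass_deriv r| ≤ 16 * π := by
  have h := norm_integral_le_of_norm_le (integrable_inv_one_add_sq.const_mul 16)
    (Eventually.of_forall (soliton_mass_deriv_integrand_le hr))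
  rwa [integral_const_mul, integral_univ_inv_one_add_sq] at h

lemma abs_soliton_mass_sub_le {r t : ℝ} (hr : 1 / 2 < r) (ht : 1 / 2 < t) :
    |soliton_mass t - soliton_mass r| ≤ 16 * π * |t - r| :=
  (convex_Ioi (1 / 2 : ℝ)).norm_image_sub_le_of_norm_hasDerivWithin_le
    (fun _ hx => (hasDerivAt_soliton_mass hx).hasDerivWithinAt)
    (fun _ hx => abs_soliton_mass_deriv_le hx) hr ht

lemma soliton_mass_one_pos : 0 < soliton_mass 1 := by
  have hpos (s : ℝ) : 0 < ((1 + 1 * Real.cosh s) ^ 2)⁻¹ := by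
    have := Real.cosh_pos s
    positivity
  refine (integral_pos_iff_support_of_nonneg (fun s => (hpos s).le)
    (integrable_soliton_mass_integrand (by norm_num))).2 ?_
  rw [Function.support_eq_univ fun s => (hpos s).ne']
  simp

lemma integral_QG_sq {c : ℝ} (hc : 0 < c) (β : ℝ) :
    ∫ x : ℝ, QG c β x ^ 2 = 9 * (c * √c) * soliton_mass √(1 - 9 / 2 * β * c) := by
  have h (x : ℝ) : QG c β x ^ 2 = 9 * c ^ 2 *
      ((1 + √(1 - 9 / 2 * β * c) * Real.cosh (√c * x)) ^ 2)⁻¹ := by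
    rw [QG, div_pow, div_eq_mul_inv]; ring
  have hs : 0 < √c := Real.sqrt_pos.2 hc
  simp only [h]
  rw [integral_const_mul, Measure.integral_comp_mul_left
    (fun y => ((1 + √(1 - 9 / 2 * β * c) * Real.cosh y) ^ 2)⁻¹),
    abs_of_pos (inv_pos.2 hs), smul_eq_mul, ← soliton_mass]
  have h2 : c ^ 2 = c * √c * √c := by rw [mul_assoc, Real.mul_self_sqrt hc.le]; ring
  rw [h2]
  field_simp

lemma integral_Q_one_sq : ∫ x : ℝ, Q 1 x ^ 2 = 9 * soliton_mass 1 := by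
  rw [soliton_mass, ← integral_const_mul]
  congr 1 with x
  rw [Q, div_pow, div_eq_mul_inv, Real.sqrt_one]
  norm_num

lemma hasDerivAt_integral_QG_sq {c β : ℝ} (hc : 0 < c) (hr : 1 / 2 < √(1 - 9 / 2 * β * c)) :
    HasDerivAt (fun c' : ℝ => ∫ x : ℝ, QG c' β x ^ 2)
      (27 / 2 * √c * soliton_mass √(1 - 9 / 2 * β * c) +
        9 * (c * √c) * (soliton_mass_deriv √(1 - 9 / 2 * β * c) *
          (-(9 / 4 * β) / √(1 - 9 / 2 * β * c)))) c := by
  have hs : 0 < √c := Real.sqrt_pos.2 hc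
  have hpos : 0 < 1 - 9 / 2 * β * c := Real.sqrt_pos.1 (by linarith)
  have hρ : HasDerivAt (fun c' : ℝ => √(1 - 9 / 2 * β * c'))
      (-(9 / 4 * β) / √(1 - 9 / 2 * β * c)) c := by
    refine (((hasDerivAt_id' c).const_mul (9 / 2 * β)).const_sub 1
      |>.sqrt hpos.ne').congr_deriv ?_
    ring
  have hcs : HasDerivAt (fun c' : ℝ => 9 * (c' * √c')) (27 / 2 * √c) c := by
    refine (((hasDerivAt_id' c).fun_mul (Real.hasDerivAt_sqrt hc.ne')).const_mul 9).congr_deriv ?_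
    field_simp
    rw [Real.sq_sqrt hc.le]
    ring
  refine (hcs.mul ((hasDerivAt_soliton_mass hr).comp c hρ)).congr_of_eventuallyEq ?_
  filter_upwards [lt_mem_nhds hc] with c' hc'
  exact integral_QG_sq hc' β

/-- Weinstein's criterium for the Gardner soliton: for `β` small,
`∂_c ∫ Q_{c,β}² = (3/2) c^{1/2} ∫ Q² + O(β) > 0`. -/
theorem gardner_weinstein_criterium (c : ℝ) (hc : 0 < c) :
    ∃ β₀ K : ℝ, 0 < β₀ ∧ 0 < K ∧ ∀ β : ℝ, 0 < β → β < β₀ →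
      c < 2 / (9 * β) ∧
      ∃ d : ℝ, HasDerivAt (fun c' : ℝ => ∫ x : ℝ, (QG c' β x) ^ 2) d c ∧
        |d - 3 / 2 * Real.sqrt c * ∫ x : ℝ, (Q 1 x) ^ 2| ≤ K * β ∧
        0 < d := by
  have hs : 0 < √c := Real.sqrt_pos.2 hc
  have hm := soliton_mass_one_pos
  have hπ := Real.pi_pos
  set L := 3 / 2 * √c * ∫ x : ℝ, Q 1 x ^ 2 with hL
  rw [integral_Q_one_sq] at hL
  have hLpos : 0 < L := by rw [hL]; positivity
  set K := 405 / 4 * (c * √c) * (16 * π) with hK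
  have hKpos : 0 < K := by positivity
  refine ⟨min (1 / (6 * c)) (L / K), K, by positivity, hKpos, fun β hβ hβ₀ => ?_⟩
  obtain ⟨hβc, hβK⟩ := lt_min_iff.1 hβ₀
  rw [lt_div_iff₀ (by positivity)] at hβc hβK
  have hbc : 0 < β * c := by positivity
  set ρ := √(1 - 9 / 2 * β * c) with hρ
  have hr : 1 / 2 < ρ := by
    rw [hρ]
    apply Real.lt_sqrt_of_sq_lt
    linarith
  have hρsq : ρ ^ 2 = 1 - 9 / 2 * β * c := Real.sq_sqrt (by linarith)
  have hsub : |ρ - 1| ≤ 9 / 2 * β * c := by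
    rw [abs_le]
    constructor <;> nlinarith
  have h1 : |soliton_mass ρ - soliton_mass 1| ≤ 16 * π * (9 / 2 * β * c) :=
    (abs_soliton_mass_sub_le (by norm_num) hr).trans (by gcongr)
  have h2 : |soliton_mass_deriv ρ * (-(9 / 4 * β) / ρ)| ≤ 16 * π * (9 / 2 * β) := by
    rw [abs_mul]
    gcongr
    · exact abs_soliton_mass_deriv_le hr
    · rw [neg_div, abs_neg, abs_of_pos (by positivity), div_le_iff₀ (by positivity)]
      nlinarith
  have hbound : |27 / 2 * √c * soliton_mass ρ +
      9 * (c * √c) * (soliton_mass_deriv ρ * (-(9 / 4 * β) / ρ)) - L| ≤ K * β := by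
    calc _ = |27 / 2 * √c * (soliton_mass ρ - soliton_mass 1) +
        9 * (c * √c) * (soliton_mass_deriv ρ * (-(9 / 4 * β) / ρ))| := by
          rw [hL]; congr 1; ring
      _ ≤ 27 / 2 * √c * |soliton_mass ρ - soliton_mass 1| +
        9 * (c * √c) * |soliton_mass_deriv ρ * (-(9 / 4 * β) / ρ)| := by
          refine (abs_add_le _ _).trans (le_of_eq ?_)
          rw [abs_mul, abs_mul (9 * (c * √c)), abs_of_pos (by positivity : 0 < 27 / 2 * √c),
            abs_of_pos (by positivity : 0 < 9 * (c * √c))]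
      _ ≤ 27 / 2 * √c * (16 * π * (9 / 2 * β * c)) + 9 * (c * √c) * (16 * π * (9 / 2 * β)) := by
          gcongr
      _ = K * β := by rw [hK]; ring
  refine ⟨?_, _, hasDerivAt_integral_QG_sq hc hr, hbound, ?_⟩
  · rw [lt_div_iff₀ (by positivity)]
    linarith
  · have := (abs_le.1 hbound).1
    linarith
end

section
/- Let β > 0 and let v : ℝ × ℝ → ℝ be smooth. Define u := v − (3/2)√(2β) ∂_x v − (3/2) β v² and G := ∂_t v + ∂_x³ v + 2 v ∂_x v − 3 β v² ∂_x v. Then the following factorization identity holds at every point (t,x) ∈ ℝ²: ∂_t u + ∂_x³ u + 2 u ∂_x u = G − (3/2)√(2β) ∂_x G − 3 β v G. -/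
open Real

section PartialDerivatives

open scoped ContDiff

variable {f : ℝ → ℝ → ℝ}

lemma hasDerivAt_snd_of_contDiff (hf : ContDiff ℝ ∞ (Function.uncurry f)) (t x : ℝ) :
    HasDerivAt (f t) (fderiv ℝ (Function.uncurry f) (t, x) (0, 1)) x :=
  ((hf.differentiable (by simp)) (t, x)).hasFDerivAt.comp_hasDerivAt x
    ((hasDerivAt_const x t).prodMk (hasDerivAt_id x))

lemma hasDerivAt_fst_of_contDiff (hf : ContDiff ℝ ∞ (Function.uncurry f)) (t x : ℝ) :
    HasDerivAt (fun τ => f τ x) (fderiv ℝ (Function.uncurry f) (t, x) (1, 0)) t :=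
  ((hf.differentiable (by simp)) (t, x)).hasFDerivAt.comp_hasDerivAt
    (f := fun τ : ℝ => (τ, x)) t ((hasDerivAt_id t).prodMk (hasDerivAt_const t x))

lemma uncurry_deriv_snd (hf : ContDiff ℝ ∞ (Function.uncurry f)) :
    (Function.uncurry fun t x => deriv (f t) x) =
      fun p => fderiv ℝ (Function.uncurry f) p (0, 1) :=
  funext fun p => (hasDerivAt_snd_of_contDiff hf p.1 p.2).deriv

lemma uncurry_deriv_fst (hf : ContDiff ℝ ∞ (Function.uncurry f)) :
    (Function.uncurry fun t x => deriv (fun τ => f τ x) t) =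
      fun p => fderiv ℝ (Function.uncurry f) p (1, 0) :=
  funext fun p => (hasDerivAt_fst_of_contDiff hf p.1 p.2).deriv

lemma contDiff_uncurry_deriv_snd (hf : ContDiff ℝ ∞ (Function.uncurry f)) :
    ContDiff ℝ ∞ (Function.uncurry fun t x => deriv (f t) x) := by
  rw [uncurry_deriv_snd hf]
  exact (hf.fderiv_right (by simp)).clm_apply contDiff_const

lemma contDiff_uncurry_deriv_fst (hf : ContDiff ℝ ∞ (Function.uncurry f)) :
    ContDiff ℝ ∞ (Function.uncurry fun t x => deriv (fun τ => f τ x) t) := by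
  rw [uncurry_deriv_fst hf]
  exact (hf.fderiv_right (by simp)).clm_apply contDiff_const

lemma deriv_fst_deriv_snd_comm (hf : ContDiff ℝ ∞ (Function.uncurry f)) (t x : ℝ) :
    deriv (fun τ => deriv (f τ) x) t = deriv (fun y => deriv (fun τ => f τ y) t) x := by
  have hd : DifferentiableAt ℝ (fderiv ℝ (Function.uncurry f)) (t, x) :=
    (hf.fderiv_right (m := ∞) (by simp)).differentiable (by simp) _
  have hsymm : IsSymmSndFDerivAt ℝ (Function.uncurry f) (t, x) :=
    hf.contDiffAt.isSymmSndFDerivAt (by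
      rw [minSmoothness_of_isRCLikeNormedField]
      exact WithTop.coe_le_coe.2 (le_top : (2 : ℕ∞) ≤ ⊤))
  rw [(hasDerivAt_fst_of_contDiff (contDiff_uncurry_deriv_snd hf) t x).deriv,
    (hasDerivAt_snd_of_contDiff (contDiff_uncurry_deriv_fst hf) t x).deriv,
    uncurry_deriv_snd hf, uncurry_deriv_fst hf,
    fderiv_clm_apply hd (differentiableAt_const _), fderiv_clm_apply hd (differentiableAt_const _)]
  simpa using hsymm.eq (1, 0) (0, 1)

lemma hasDerivAt_deriv_snd (hf : ContDiff ℝ ∞ (Function.uncurry f)) (t x : ℝ) :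
    HasDerivAt (f t) (deriv (f t) x) x :=
  (hasDerivAt_snd_of_contDiff hf t x).differentiableAt.hasDerivAt

lemma hasDerivAt_deriv_fst (hf : ContDiff ℝ ∞ (Function.uncurry f)) (t x : ℝ) :
    HasDerivAt (fun τ => f τ x) (deriv (fun τ => f τ x) t) t :=
  (hasDerivAt_fst_of_contDiff hf t x).differentiableAt.hasDerivAt

end PartialDerivatives

/-- The Gardner-transform factorization identity: if
`u = M_β[v] = v - (3/2)√(2β) v_x - (3/2) β v²` and
`G = v_t + v_xxx + 2 v v_x - 3 β v² v_x` (the Gardner operator applied to `v`),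
then `u_t + u_xxx + 2 u u_x = G - (3/2)√(2β) G_x - 3 β v G` pointwise. -/
theorem gardner_transform_factorization
    (β : ℝ) (hβ : 0 < β) (v : ℝ → ℝ → ℝ) (hv : ContDiff ℝ (⊤ : ℕ∞) (Function.uncurry v))
    (u G : ℝ → ℝ → ℝ)
    (hu : ∀ t x : ℝ, u t x =
      v t x - 3 / 2 * Real.sqrt (2 * β) * deriv (v t) x - 3 / 2 * β * (v t x) ^ 2)
    (hG : ∀ t x : ℝ, G t x =
      deriv (fun τ => v τ x) t + iteratedDeriv 3 (v t) x +
        2 * v t x * deriv (v t) x - 3 * β * (v t x) ^ 2 * deriv (v t) x) :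
    ∀ t x : ℝ,
      deriv (fun τ => u τ x) t + iteratedDeriv 3 (u t) x + 2 * u t x * deriv (u t) x =
        G t x - 3 / 2 * Real.sqrt (2 * β) * deriv (G t) x - 3 * β * v t x * G t x := by
  intro t x
  have hv₁ := contDiff_uncurry_deriv_snd hv
  have hv₂ := contDiff_uncurry_deriv_snd hv₁
  have hv₃ := contDiff_uncurry_deriv_snd hv₂
  have d₀ := hasDerivAt_deriv_snd hv t
  have d₁ := hasDerivAt_deriv_snd hv₁ t
  have d₂ := hasDerivAt_deriv_snd hv₂ t
  have d₃ := hasDerivAt_deriv_snd hv₃ t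
  have e := hasDerivAt_deriv_snd (contDiff_uncurry_deriv_fst hv) t x
  have comm := deriv_fst_deriv_snd_comm hv t x
  have s₀ := hasDerivAt_deriv_fst hv t x
  have s₁ := hasDerivAt_deriv_fst hv₁ t x
  have iter_three (g : ℝ → ℝ) : iteratedDeriv 3 g = deriv (deriv (deriv g)) := by
    simp [iteratedDeriv_succ, iteratedDeriv_zero]
  have hu' : u t = fun y =>
      v t y - 3 / 2 * √(2 * β) * deriv (v t) y - 3 / 2 * β * (v t y) ^ 2 := funext (hu t)
  have hc : √(2 * β) ^ 2 = 2 * β := Real.sq_sqrt (by positivity)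
  have hut : deriv (fun τ => u τ x) t = deriv (fun τ => v τ x) t
      - 3 / 2 * √(2 * β) * deriv (fun τ => deriv (v τ) x) t
      - 3 * β * v t x * deriv (fun τ => v τ x) t := by
    simp only [hu]
    refine (((s₀.sub (s₁.const_mul (3 / 2 * √(2 * β)))).sub
      ((s₀.pow 2).const_mul (3 / 2 * β))).congr_deriv ?_).deriv
    push_cast; ring
  have hux : deriv (u t) = fun y => deriv (v t) y - 3 / 2 * √(2 * β) * deriv (deriv (v t)) y
      - 3 * β * (v t y * deriv (v t) y) := by
    funext y
    rw [hu']
    refine ((((d₀ y).sub ((d₁ y).const_mul (3 / 2 * √(2 * β)))).sub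
      (((d₀ y).pow 2).const_mul (3 / 2 * β))).congr_deriv ?_).deriv
    push_cast; ring
  have huxx : deriv (deriv (u t)) = fun y => deriv (deriv (v t)) y
      - 3 / 2 * √(2 * β) * deriv (deriv (deriv (v t))) y
      - 3 * β * (deriv (v t) y * deriv (v t) y + v t y * deriv (deriv (v t)) y) := by
    funext y
    rw [hux]
    exact (((d₁ y).sub ((d₂ y).const_mul (3 / 2 * √(2 * β)))).sub
      (((d₀ y).mul (d₁ y)).const_mul (3 * β))).deriv
  have huxxx : deriv (deriv (deriv (u t))) x = deriv (deriv (deriv (v t))) x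
      - 3 / 2 * √(2 * β) * deriv (deriv (deriv (deriv (v t)))) x
      - 3 * β * (3 * deriv (v t) x * deriv (deriv (v t)) x
        + v t x * deriv (deriv (deriv (v t))) x) := by
    rw [huxx]
    refine ((((d₂ x).sub ((d₃ x).const_mul (3 / 2 * √(2 * β)))).sub
      ((((d₁ x).mul (d₁ x)).add ((d₀ x).mul (d₂ x))).const_mul (3 * β))).congr_deriv ?_).deriv
    ring
  have hGx : deriv (G t) x = deriv (fun y => deriv (fun τ => v τ y) t) x
      + deriv (deriv (deriv (deriv (v t)))) x
      + (2 * deriv (v t) x * deriv (v t) x + 2 * v t x * deriv (deriv (v t)) x)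
      - (6 * β * v t x * deriv (v t) x * deriv (v t) x
        + 3 * β * v t x ^ 2 * deriv (deriv (v t)) x) := by
    rw [funext (hG t), iter_three]
    refine ((((e.add (d₃ x)).add (((d₀ x).const_mul 2).mul (d₁ x))).sub
      ((((d₀ x).pow 2).const_mul (3 * β)).mul (d₁ x))).congr_deriv ?_).deriv
    push_cast; simp only [Pi.pow_apply]; ring
  rw [hut, iter_three, huxxx, hux, hGx, hG, hu, comm, iter_three]
  linear_combination (9 / 2 * deriv (v t) x * deriv (deriv (v t)) x) * hc
end

section
/- Let β > 0 and let v : ℝ × ℝ → ℝ be a smooth function satisfying the Gardner equation ∂_t v + ∂_x(∂_x² v + v² − β v³) = 0 at every point. Then the function u := v − (3/2)√(2β) ∂_x v − (3/2) β v² (the Gardner transform of v) satisfies the KdV equation ∂_t u + ∂_x(∂_x² u + u²) = 0 at every point. -/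
/-- A smooth function of two real variables has a smooth partial derivative in the second one. -/
lemma exists_smooth_partial_snd {f : ℝ → ℝ → ℝ}
    (hf : ContDiff ℝ (⊤ : ℕ∞) (Function.uncurry f)) :
    ∃ g : ℝ → ℝ → ℝ, ContDiff ℝ (⊤ : ℕ∞) (Function.uncurry g) ∧
      ∀ t x, HasDerivAt (f t) (g t x) x := by
  refine ⟨fun t x => fderiv ℝ (Function.uncurry f) (t, x) (0, 1), ?_, fun t x => ?_⟩
  · exact (hf.fderiv_right (m := (⊤ : ℕ∞)) (by simp)).clm_apply contDiff_const
  · have h := (hf.differentiable (by simp) (t, x)).hasFDerivAt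
    exact h.comp_hasDerivAt x ((hasDerivAt_const x t).prodMk (hasDerivAt_id x))

/-- A smooth function of two real variables has a partial derivative in the first one. -/
lemma exists_partial_fst {f : ℝ → ℝ → ℝ}
    (hf : ContDiff ℝ (⊤ : ℕ∞) (Function.uncurry f)) :
    ∃ g : ℝ → ℝ → ℝ, ∀ t x, HasDerivAt (fun τ => f τ x) (g t x) t := by
  refine ⟨fun t x => fderiv ℝ (Function.uncurry f) (t, x) (1, 0), fun t x => ?_⟩
  have h := (hf.differentiable (by simp) (t, x)).hasFDerivAt
  exact h.comp_hasDerivAt t ((hasDerivAt_id t).prodMk (hasDerivAt_const t x))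

/-- Mixed partial derivatives of a smooth function of two real variables commute. -/
lemma hasDerivAt_partial_snd_of_hasDerivAt_partial_fst {f fx ft : ℝ → ℝ → ℝ}
    (hf : ContDiff ℝ (⊤ : ℕ∞) (Function.uncurry f))
    (hfx : ∀ t x, HasDerivAt (f t) (fx t x) x)
    (hft : ∀ t x, HasDerivAt (fun τ => f τ x) (ft t x) t)
    {t x d : ℝ} (hd : HasDerivAt (ft t) d x) :
    HasDerivAt (fun τ => fx τ x) d t := by
  have h (p : ℝ × ℝ) := (hf.differentiable (by simp) p).hasFDerivAt
  have hfx' (s y : ℝ) : fx s y = fderiv ℝ (Function.uncurry f) (s, y) (0, 1) :=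
    (hfx s y).unique ((h (s, y)).comp_hasDerivAt y
      ((hasDerivAt_const y s).prodMk (hasDerivAt_id y)))
  have hft' (s y : ℝ) : ft s y = fderiv ℝ (Function.uncurry f) (s, y) (1, 0) :=
    (hft s y).unique ((h (s, y)).comp_hasDerivAt (f := fun τ => (τ, y)) s
      ((hasDerivAt_id s).prodMk (hasDerivAt_const s y)))
  have h2 := (((hf.fderiv_right (m := (⊤ : ℕ∞)) (by simp)).differentiable
    (by simp)) (t, x)).hasFDerivAt
  have hsymm := (hf.contDiffAt (x := (t, x))).isSymmSndFDerivAt (by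
    simp only [minSmoothness_of_isRCLikeNormedField]
    exact WithTop.coe_le_coe.2 (le_top (a := (2 : ℕ∞))))
  have ht := (h2.comp_hasDerivAt (f := fun τ => (τ, x)) t
    ((hasDerivAt_id t).prodMk (hasDerivAt_const t x))).clm_apply
      (hasDerivAt_const t ((0 : ℝ), (1 : ℝ)))
  have hx := (h2.comp_hasDerivAt x
    ((hasDerivAt_const x t).prodMk (hasDerivAt_id x))).clm_apply
      (hasDerivAt_const x ((1 : ℝ), (0 : ℝ)))
  rw [funext (hft' t)] at hd
  have hd' := hd.unique hx
  simp only [hfx']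
  refine ht.congr_deriv ?_
  rw [hd']
  simpa using hsymm.eq (1, 0) (0, 1)

/-- The Gardner transform maps smooth pointwise solutions of the Gardner equation
`v_t + (v_xx + v² - β v³)_x = 0` to pointwise solutions of the KdV equation
`u_t + (u_xx + u²)_x = 0`. -/
theorem gardner_transform_maps_gardner_to_kdv
    (β : ℝ) (hβ : 0 < β) (v : ℝ → ℝ → ℝ) (hv : ContDiff ℝ (⊤ : ℕ∞) (Function.uncurry v))
    (hveq : ∀ t x : ℝ,
      deriv (fun τ => v τ x) t +
        deriv (fun y => deriv (deriv (v t)) y + (v t y) ^ 2 - β * (v t y) ^ 3) x = 0)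
    (u : ℝ → ℝ → ℝ)
    (hu : ∀ t x : ℝ, u t x =
      v t x - 3 / 2 * Real.sqrt (2 * β) * deriv (v t) x - 3 / 2 * β * (v t x) ^ 2) :
    ∀ t x : ℝ,
      deriv (fun τ => u τ x) t +
        deriv (fun y => deriv (deriv (u t)) y + (u t y) ^ 2) x = 0 := by
  obtain ⟨v1, s1, h1⟩ := exists_smooth_partial_snd hv
  obtain ⟨v2, s2, h2⟩ := exists_smooth_partial_snd s1
  obtain ⟨v3, s3, h3⟩ := exists_smooth_partial_snd s2
  obtain ⟨v4, -, h4⟩ := exists_smooth_partial_snd s3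
  obtain ⟨vt, ht⟩ := exists_partial_fst hv
  have d1 (t : ℝ) : deriv (v t) = v1 t := funext fun x => (h1 t x).deriv
  have d2 (t : ℝ) : deriv (v1 t) = v2 t := funext fun x => (h2 t x).deriv
  have evt (t x : ℝ) :
      vt t x = -(v3 t x + 2 * v t x * v1 t x - β * (3 * v t x ^ 2 * v1 t x)) := by
    have h := hveq t x
    have hflux := (((h3 t x).add ((h1 t x).pow 2)).sub (((h1 t x).pow 3).const_mul β)).deriv
    simp only [d1, d2] at h
    rw [(ht t x).deriv] at h
    erw [hflux] at h
    norm_num at h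
    linarith
  set a := 3 / 2 * Real.sqrt (2 * β) with ha
  have ha2 : a ^ 2 = 9 / 2 * β := by
    rw [ha, mul_pow, Real.sq_sqrt (by positivity)]
    ring
  have eu (t : ℝ) : u t = fun x => v t x - a * v1 t x - 3 / 2 * β * v t x ^ 2 := by
    funext x
    rw [hu, d1]
  have hu1 (t x : ℝ) :
      HasDerivAt (u t) (v1 t x - a * v2 t x - 3 / 2 * β * (2 * v t x * v1 t x)) x := by
    rw [eu]
    have h := ((h1 t x).sub ((h2 t x).const_mul a)).sub
      (((h1 t x).pow 2).const_mul (3 / 2 * β))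
    exact h.congr_deriv (by norm_num)
  have hu2 (t x : ℝ) :
      HasDerivAt (deriv (u t)) (v2 t x - a * v3 t x -
        3 / 2 * β * (2 * (v1 t x * v1 t x + v t x * v2 t x))) x := by
    rw [funext fun y => (hu1 t y).deriv]
    have h := ((h2 t x).sub ((h3 t x).const_mul a)).sub
      ((((h1 t x).const_mul 2).mul (h2 t x)).const_mul (3 / 2 * β))
    exact h.congr_deriv (by ring)
  have hu3 (t x : ℝ) :
      HasDerivAt (deriv (deriv (u t))) (v3 t x - a * v4 t x -
        3 / 2 * β * (2 * (3 * v1 t x * v2 t x + v t x * v3 t x))) x := by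
    rw [funext fun y => (hu2 t y).deriv]
    have h := ((h3 t x).sub ((h4 t x).const_mul a)).sub
      (((((h2 t x).mul (h2 t x)).add ((h1 t x).mul (h3 t x))).const_mul 2).const_mul
        (3 / 2 * β))
    exact h.congr_deriv (by ring)
  intro t x
  have hvtx : HasDerivAt (vt t) (-(v4 t x + 2 * (v1 t x * v1 t x + v t x * v2 t x) -
      β * (3 * (2 * v t x * v1 t x * v1 t x + v t x ^ 2 * v2 t x)))) x := by
    rw [funext (evt t)]
    have h := (((h4 t x).add (((h1 t x).const_mul 2).mul (h2 t x))).sub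
      (((((h1 t x).pow 2).const_mul 3).mul (h2 t x)).const_mul β)).neg
    exact h.congr_deriv (by simp only [Pi.pow_apply]; push_cast; ring)
  have hv1t := hasDerivAt_partial_snd_of_hasDerivAt_partial_fst hv h1 ht hvtx
  have hut := ((ht t x).sub (hv1t.const_mul a)).sub (((ht t x).pow 2).const_mul (3 / 2 * β))
  have hut' := hut.congr_of_eventuallyEq
    (Filter.Eventually.of_forall fun τ => congrFun (eu τ) x)
  have hflux := ((hu3 t x).add ((hu1 t x).pow 2)).deriv
  rw [hut'.deriv]
  erw [hflux]
  rw [evt t x, eu t]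
  norm_num
  linear_combination (2 * v1 t x * v2 t x) * ha2
end

section
/- Let β > 0 and let v : ℝ × ℝ → ℝ be a smooth function satisfying the Gardner equation ∂_t v + ∂_x(∂_x² v + v² − β v³) = 0 at every point. Define ṽ(t,x) := 1/(3√β) − √β · v(t, x + t/(3β)). Then: (i) ṽ satisfies the defocusing modified KdV equation ∂_t ṽ + ∂_x(∂_x² ṽ − ṽ³) = 0 at every point; and (ii) for all (t,x) ∈ ℝ², 1/(6β) + M[ṽ](t, x − t/(3β)) = M_β[v](t,x), where M[ṽ] = (3/√2) ∂_x ṽ − (3/2) ṽ² is the Miura transform of ṽ and M_β[v] = v − (3/2)√(2β) ∂_x v − (3/2) β v² is the Gardner transform of v. -/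
open Real

/-- The derivative of a jointly differentiable function along the line `τ ↦ (τ, x + τ / k)` is the
sum of its two partial derivatives, the second one weighted by the slope. -/
theorem hasDerivAt_along_moving_frame {v : ℝ → ℝ → ℝ}
    (hv : Differentiable ℝ (Function.uncurry v)) (k t x : ℝ) :
    HasDerivAt (fun τ => v τ (x + τ / k))
      (deriv (fun τ => v τ (x + t / k)) t + 1 / k * deriv (v t) (x + t / k)) t := by
  have hF := (hv (t, x + t / k)).hasFDerivAt
  set L := fderiv ℝ (Function.uncurry v) (t, x + t / k)
  have h_line : HasDerivAt (fun τ : ℝ => (τ, x + τ / k)) ((1 : ℝ), 1 / k) t :=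
    (hasDerivAt_id t).prodMk (((hasDerivAt_id t).div_const k).const_add x)
  have h_time : HasDerivAt (fun τ => v τ (x + t / k)) (L (1, 0)) t :=
    HasFDerivAt.comp_hasDerivAt t (f := fun τ : ℝ => (τ, x + t / k)) hF
      ((hasDerivAt_id t).prodMk (hasDerivAt_const t _))
  have h_space : HasDerivAt (v t) (L (0, 1)) (x + t / k) :=
    HasFDerivAt.comp_hasDerivAt (x + t / k) (f := fun y : ℝ => (t, y)) hF
      ((hasDerivAt_const _ t).prodMk (hasDerivAt_id _))
  have h_split : L (1, 1 / k) = L (1, 0) + 1 / k * L (0, 1) := by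
    rw [← smul_eq_mul, ← map_smul, ← map_add]
    simp
  rw [h_time.deriv, h_space.deriv, ← h_split]
  exact HasFDerivAt.comp_hasDerivAt t (f := fun τ : ℝ => (τ, x + τ / k)) hF h_line

/-- The derivative of an affine function of a translate. -/
theorem deriv_const_sub_const_mul_comp_add_const (f : ℝ → ℝ) (a b c : ℝ) :
    deriv (fun y => a - b * f (y + c)) = fun y => -(b * deriv f (y + c)) := by
  funext y
  rw [deriv_const_sub, deriv_const_mul_field, deriv_comp_add_const]

/-- If `v` is a smooth pointwise solution of the Gardner equation
`v_t + (v_xx + v² - β v³)_x = 0`, then `ṽ(t,x) = 1/(3√β) - √β v(t, x + t/(3β))`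
solves the defocusing mKdV equation `ṽ_t + (ṽ_xx - ṽ³)_x = 0`, and the Gardner
transform of `v` is recovered from the Miura transform of `ṽ`:
`1/(6β) + M[ṽ](t, x - t/(3β)) = M_β[v](t,x)`. -/
theorem gardner_transform_via_miura
    (β : ℝ) (hβ : 0 < β) (v : ℝ → ℝ → ℝ) (hv : ContDiff ℝ (⊤ : ℕ∞) (Function.uncurry v))
    (hveq : ∀ t x : ℝ,
      deriv (fun τ => v τ x) t +
        deriv (fun y => deriv (deriv (v t)) y + (v t y) ^ 2 - β * (v t y) ^ 3) x = 0)
    (w : ℝ → ℝ → ℝ)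
    (hw : ∀ t x : ℝ, w t x =
      1 / (3 * Real.sqrt β) - Real.sqrt β * v t (x + t / (3 * β))) :
    (∀ t x : ℝ,
      deriv (fun τ => w τ x) t +
        deriv (fun y => deriv (deriv (w t)) y - (w t y) ^ 3) x = 0) ∧
    (∀ t x : ℝ,
      1 / (6 * β) +
        (3 / Real.sqrt 2 * deriv (w t) (x - t / (3 * β))
          - 3 / 2 * (w t (x - t / (3 * β))) ^ 2) =
      v t x - 3 / 2 * Real.sqrt (2 * β) * deriv (v t) x - 3 / 2 * β * (v t x) ^ 2) := by
  obtain ⟨s, hs⟩ : ∃ s, s = √β := ⟨_, rfl⟩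
  have hs_pos : 0 < s := hs ▸ Real.sqrt_pos.2 hβ
  have hβs : β = s ^ 2 := by rw [hs, Real.sq_sqrt hβ.le]
  have hw_eq (t : ℝ) : w t = fun y => 1 / (3 * s) - s * v t (y + t / (3 * β)) := by
    funext y
    rw [hw, hs]
  have hdw (t : ℝ) : deriv (w t) = fun y => -(s * deriv (v t) (y + t / (3 * β))) := by
    rw [hw_eq, deriv_const_sub_const_mul_comp_add_const]
  have hddw (t : ℝ) :
      deriv (deriv (w t)) = fun y => -(s * deriv (deriv (v t)) (y + t / (3 * β))) := by
    rw [hdw]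
    simpa using deriv_const_sub_const_mul_comp_add_const (deriv (v t)) 0 s (t / (3 * β))
  refine ⟨fun t x => ?_, fun t x => ?_⟩
  · have hvt : ContDiff ℝ (3 : ℕ) (v t) :=
      contDiff_infty.1 (hv.comp (contDiff_const.prodMk contDiff_id)) 3
    have h_space (y : ℝ) : HasDerivAt (v t) (deriv (v t) y) y :=
      (hvt.differentiable (by norm_num) y).hasDerivAt
    have h_third (y : ℝ) :
        HasDerivAt (deriv (deriv (v t))) (deriv (deriv (deriv (v t))) y) y := by
      have h := hvt.differentiable_iteratedDeriv 2 (by norm_num)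
      rw [iteratedDeriv_succ, iteratedDeriv_one] at h
      exact (h y).hasDerivAt
    have h_time := ((hasDerivAt_along_moving_frame (hv.differentiable (by simp))
      (3 * β) t x).const_mul s).const_sub (1 / (3 * s))
    have h_wt : (fun τ => w τ x) = fun τ => 1 / (3 * s) - s * v τ (x + τ / (3 * β)) := by
      funext τ
      rw [hw, hs]
    have h_eq := hveq t (x + t / (3 * β))
    have h_flux_v := ((h_third (x + t / (3 * β))).add ((h_space _).pow 2)).sub
      (((h_space _).pow 3).const_mul β)
    replace h_eq := (congrArg _ h_flux_v.deriv.symm).trans h_eq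
    have h_flux := (((h_third _).comp_add_const x (t / (3 * β))).const_mul s).neg.sub
      (((((h_space _).comp_add_const x (t / (3 * β))).const_mul s).const_sub (1 / (3 * s))).pow 3)
    rw [h_wt, h_time.deriv, hddw, hw_eq]
    refine (congrArg _ h_flux.deriv).trans ?_
    generalize t / (3 * β) = c at *
    generalize deriv (fun τ => v τ (x + c)) t = vt at *
    generalize deriv (v t) (x + c) = vx at *
    generalize deriv (deriv (deriv (v t))) (x + c) = vxxx at *
    have h_vt : vt = -(vxxx + 2 * v t (x + c) * vx - β * (3 * v t (x + c) ^ 2 * vx)) := by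
      norm_num at h_eq
      linarith
    rw [h_vt, hβs]
    norm_num
    field_simp
    ring
  · have h_two : √2 ^ 2 = 2 := Real.sq_sqrt (by norm_num)
    have h_inv : 3 / √2 = 3 / 2 * √2 := by
      field_simp
      linarith
    rw [hdw, hw_eq, Real.sqrt_mul (by norm_num), ← hs, h_inv]
    simp only [sub_add_cancel]
    rw [hβs]
    field_simp
    ring
end
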